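/- arXiv:2504.16747 — 4 statements merged into one kernel-verified Lean document; each statement's English description precedes it below -/
import Mathlib

section
/- MZV duality: ζ(4) = ζ(2,1,1), i.e. ∑_{n≥1} 1/n⁴ = ∑_{n>m>k≥1} 1/(n²mk). -/
open Filter Topology

noncomputable def conn (n m : ℕ) : ℝ := (n.factorial * m.factorial : ℝ) / ((n + m).factorial : ℝ)

lemma conn_nonneg (n m : ℕ) : 0 ≤ conn n m := by unfold conn; positivity

lemma conn_comm (n m : ℕ) : conn n m = conn m n := by
  unfold conn; rw [add_comm n m, mul_comm]

lemma conn_zero (n : ℕ) : conn n 0 = 1 := by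
  unfold conn
  have : (n.factorial : ℝ) ≠ 0 := by positivity
  simp [this]

lemma conn_le_one (n m : ℕ) : conn n m ≤ 1 := by
  unfold conn
  rw [div_le_one (by positivity)]
  exact_mod_cast Nat.le_of_dvd (Nat.factorial_pos _) (Nat.factorial_mul_factorial_dvd_factorial_add n m)

lemma conn_succ (n m : ℕ) : conn (n + 1) m = conn n m * ((n + 1) / (n + 1 + m)) := by
  unfold conn
  have h : n + 1 + m = (n + m) + 1 := by ring
  rw [h, Nat.factorial_succ, Nat.factorial_succ]
  have : ((n + m).factorial : ℝ) ≠ 0 := by positivity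
  have h2 : (n + 1 + m : ℝ) ≠ 0 := by positivity
  have h3 : (n + m + 1 : ℝ) ≠ 0 := by positivity
  push_cast
  field_simp
  ring

lemma conn_step (n m : ℕ) (hn : 0 < n) :
    conn n (m + 1) / ((m + 1 : ℕ) : ℝ) = (conn n m - conn n (m + 1)) / n := by
  rw [conn_comm n (m + 1), conn_succ, conn_comm n m]
  have h2 : (m + 1 + n : ℝ) ≠ 0 := by positivity
  have h3 : (n : ℝ) ≠ 0 := by positivity
  push_cast
  field_simp
  ring

lemma conn_tendsto (n : ℕ) (hn : 0 < n) : Tendsto (fun b => conn n b) atTop (𝓝 0) := by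
  obtain ⟨n, rfl⟩ : ∃ k, n = k + 1 := ⟨n - 1, by omega⟩
  have h : Tendsto (fun b : ℕ => ((n : ℝ) + 1) / ((n : ℝ) + 1 + b)) atTop (𝓝 0) :=
    Tendsto.div_atTop tendsto_const_nhds
      (tendsto_atTop_add_const_left _ _ tendsto_natCast_atTop_atTop)
  refine squeeze_zero (fun b => conn_nonneg _ _) (fun b => ?_) h
  rw [conn_succ]
  exact mul_le_of_le_one_left (by positivity) (conn_le_one _ _)

lemma conn_hasSum (n m : ℕ) (hn : 0 < n) :
    HasSum (fun b : ℕ => if m < b then conn n b / b else 0) (conn n m / n) := by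
  rw [hasSum_iff_tendsto_nat_of_nonneg]
  · rw [← tendsto_add_atTop_iff_nat (m + 1)]
    have key : ∀ N, ∑ b ∈ Finset.range (N + (m + 1)), (if m < b then conn n b / (b : ℝ) else 0)
        = (conn n m - conn n (N + m)) / n := by
      intro N
      induction N with
      | zero =>
        rw [Finset.sum_eq_zero]
        · simp
        · intro b hb
          rw [Finset.mem_range] at hb
          rw [if_neg (by omega)]
      | succ N ih =>
        have e : N + 1 + (m + 1) = (N + (m + 1)) + 1 := by ring
        rw [e, Finset.sum_range_succ, ih, if_pos (by omega)]
        have e2 : N + (m + 1) = (N + m) + 1 := by ring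
        have e3 : N + 1 + m = (N + m) + 1 := by ring
        rw [e2, e3, conn_step n _ hn]
        ring
    simp_rw [key]
    have := ((conn_tendsto n hn).comp (tendsto_add_atTop_nat m)).const_sub (conn n m)
    simpa using this.div_const (n : ℝ)
  · intro b
    have := conn_nonneg n b
    split_ifs <;> positivity

lemma conn_ennreal (n m : ℕ) (hn : 0 < n) (x : ℝ) (hx : 0 ≤ x) :
    ∑' b : ℕ, ENNReal.ofReal (if m < b then x * (conn n b / b) else 0)
      = ENNReal.ofReal (x * (conn n m / n)) := by
  have h := (conn_hasSum n m hn).mul_left x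
  simp only [mul_ite, mul_zero] at h
  rw [← h.tsum_eq, ENNReal.ofReal_tsum_of_nonneg _ h.summable]
  intro b
  have := conn_nonneg n b
  split_ifs <;> positivity

/-- The common refinement of the two sums. -/
noncomputable def big (n k m b : ℕ) : ℝ :=
  if 0 < n ∧ 0 < k ∧ k < m ∧ m < b then conn n b / (n * k * m * b) else 0

lemma big_left (n : ℕ) :
    ∑' k, ∑' m, ∑' b, ENNReal.ofReal (big n k m b) = ENNReal.ofReal (1 / (n : ℝ) ^ 4) := by
  rcases Nat.eq_zero_or_pos n with rfl | hn
  · simp [big]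
  have h1 : ∀ k m, ∑' b, ENNReal.ofReal (big n k m b) =
      ENNReal.ofReal (if k < m then (if 0 < k then 1 / ((n : ℝ) ^ 2 * k) else 0) * (conn n m / m)
        else 0) := by
    intro k m
    by_cases h : 0 < k ∧ k < m
    · rw [if_pos h.2, if_pos h.1]
      have := conn_ennreal n m hn (1 / (n * k * m)) (by positivity)
      refine Eq.trans (tsum_congr fun b => congrArg _ ?_) (this.trans (congrArg _ ?_))
      · simp only [big, hn, h, true_and]
        split_ifs
        · field_simp
        · rfl
      · field_simp
    · have : ∀ b, big n k m b = 0 := fun b => if_neg (by tauto)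
      simp only [this]
      split_ifs <;> simp_all
  have h2 : ∀ k, ∑' m, ∑' b, ENNReal.ofReal (big n k m b) =
      ENNReal.ofReal (if 0 < k then (1 / (n : ℝ) ^ 3) * (conn n k / k) else 0) := by
    intro k
    simp_rw [h1]
    rw [conn_ennreal n k hn _ (by split_ifs <;> positivity)]
    congr 1
    split_ifs
    · field_simp
    · simp
  simp_rw [h2]
  rw [conn_ennreal n 0 hn _ (by positivity), conn_zero]
  congr 1
  field_simp

lemma big_right (k m b : ℕ) :
    ∑' n, ENNReal.ofReal (big n k m b) = ENNReal.ofReal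
      (if 0 < k ∧ k < m ∧ m < b then 1 / ((b : ℝ) ^ 2 * (m : ℝ) * (k : ℝ)) else 0) := by
  by_cases h : 0 < k ∧ k < m ∧ m < b
  · rw [if_pos h]
    have := conn_ennreal b 0 (by omega) (1 / (k * m * b)) (by positivity)
    rw [conn_zero] at this
    convert this using 3 with n
    · simp only [big, h, and_true]
      rw [conn_comm]
      split_ifs
      · field_simp
      · rfl
    · field_simp
  · have : ∀ n, big n k m b = 0 := fun n => if_neg (by tauto)
    simp [this, h]

theorem mzv_duality_wt4 :
    ∑' n : ℕ, 1 / (n : ℝ) ^ 4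
      = ∑' n : ℕ, ∑' m : ℕ, ∑' k : ℕ,
          if 0 < k ∧ k < m ∧ m < n then 1 / ((n : ℝ) ^ 2 * (m : ℝ) * (k : ℝ)) else 0 := by
  set f : ℕ → ℕ → ℕ → ℝ := fun n m k =>
    if 0 < k ∧ k < m ∧ m < n then 1 / ((n : ℝ) ^ 2 * (m : ℝ) * (k : ℝ)) else 0 with hf
  have hf0 : ∀ n m k, 0 ≤ f n m k := by
    intro n m k
    simp only [hf]
    split_ifs <;> positivity
  have key : ∑' n : ℕ, ENNReal.ofReal (1 / (n : ℝ) ^ 4)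
      = ∑' n, ∑' m, ∑' k, ENNReal.ofReal (f n m k) := by
    simp_rw [← big_left]
    calc ∑' n, ∑' k, ∑' m, ∑' b, ENNReal.ofReal (big n k m b)
        = ∑' k, ∑' n, ∑' m, ∑' b, ENNReal.ofReal (big n k m b) := ENNReal.tsum_comm
      _ = ∑' k, ∑' m, ∑' n, ∑' b, ENNReal.ofReal (big n k m b) :=
          tsum_congr fun k => ENNReal.tsum_comm
      _ = ∑' k, ∑' m, ∑' b, ∑' n, ENNReal.ofReal (big n k m b) :=
          tsum_congr fun k => tsum_congr fun m => ENNReal.tsum_comm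
      _ = ∑' k, ∑' m, ∑' b, ENNReal.ofReal (f b m k) := by simp_rw [big_right, hf]
      _ = ∑' m, ∑' k, ∑' b, ENNReal.ofReal (f b m k) := ENNReal.tsum_comm
      _ = ∑' m, ∑' b, ∑' k, ENNReal.ofReal (f b m k) :=
          tsum_congr fun m => ENNReal.tsum_comm
      _ = ∑' b, ∑' m, ∑' k, ENNReal.ofReal (f b m k) := ENNReal.tsum_comm
  have hs : Summable (fun n : ℕ => 1 / (n : ℝ) ^ 4) :=
    Real.summable_one_div_nat_pow.mpr (by norm_num)
  have hL : ∑' n : ℕ, ENNReal.ofReal (1 / (n : ℝ) ^ 4) ≠ ⊤ := by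
    rw [← ENNReal.ofReal_tsum_of_nonneg (fun n => by positivity) hs]
    exact ENNReal.ofReal_ne_top
  have hR := hL
  rw [key] at hR
  have hR1 := ENNReal.ne_top_of_tsum_ne_top hR
  have hR2 := fun n => ENNReal.ne_top_of_tsum_ne_top (hR1 n)
  have := congrArg ENNReal.toReal key
  rw [ENNReal.tsum_toReal_eq (fun n => ENNReal.ofReal_ne_top), ENNReal.tsum_toReal_eq hR1] at this
  convert this using 3 with n n
  · rw [ENNReal.toReal_ofReal (by positivity)]
  · rw [ENNReal.tsum_toReal_eq (hR2 n)]
    refine tsum_congr fun m => ?_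
    rw [ENNReal.tsum_toReal_eq (fun k => ENNReal.ofReal_ne_top)]
    exact tsum_congr fun k => (ENNReal.toReal_ofReal (hf0 n m k)).symm
end

section
/- Landen's trilogarithm formula: Li₃(1/2) = (7/8)·ζ(3) - (1/2)·ζ(2)·ln 2 + (ln 2)³/6. -/
/-- The polylogarithm series. -/
noncomputable def plog (s : ℕ) (x : ℝ) : ℝ := ∑' n : ℕ, x ^ n / (n : ℝ) ^ s

lemma plog_bound (s : ℕ) (n : ℕ) (x : ℝ) (hx : |x| ≤ 1) :
    ‖x ^ n / (n : ℝ) ^ s‖ ≤ 1 / (n : ℝ) ^ s := by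
  rw [norm_div, norm_pow, norm_pow, Real.norm_eq_abs, Real.norm_natCast]
  gcongr
  exact pow_le_one₀ (abs_nonneg x) hx

lemma plog_summable (s : ℕ) (hs : 1 < s) (x : ℝ) (hx : |x| ≤ 1) :
    Summable (fun n : ℕ => x ^ n / (n : ℝ) ^ s) :=
  Summable.of_norm_bounded (Real.summable_one_div_nat_pow.2 hs) (fun n => plog_bound s n x hx)

lemma plog_cont (s : ℕ) (hs : 1 < s) : ContinuousOn (plog s) (Set.Icc (-1) 1) := by
  unfold plog
  refine continuousOn_tsum (u := fun n : ℕ => 1 / (n : ℝ) ^ s) ?_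
    (Real.summable_one_div_nat_pow.2 hs) ?_
  · intro n
    fun_prop
  · intro n x hx
    exact plog_bound s n x (abs_le.2 hx)

lemma plog_deriv (s : ℕ) (hs : s ≠ 0) (x : ℝ) (hx : |x| < 1) (h0 : x ≠ 0) :
    HasDerivAt (plog (s + 1)) (plog s x / x) x := by
  obtain ⟨r, hxr, hr⟩ := exists_between hx
  have hr0 : 0 ≤ r := (abs_nonneg x).trans hxr.le
  have key := hasDerivAt_tsum_of_isPreconnected (𝕜 := ℝ) (F := ℝ)
    (u := fun n : ℕ => r ^ (n - 1))
    (g := fun (n : ℕ) (y : ℝ) => y ^ n / (n : ℝ) ^ (s + 1))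
    (g' := fun (n : ℕ) (y : ℝ) => ((n : ℝ) * y ^ (n - 1)) / (n : ℝ) ^ (s + 1))
    (t := Metric.ball 0 r) (y₀ := 0) (y := x)
    (by
      rw [← summable_nat_add_iff 1]
      simpa using summable_geometric_of_lt_one hr0 hr)
    Metric.isOpen_ball (convex_ball _ _).isPreconnected
    (by
      intro n y _
      exact (hasDerivAt_pow n y).div_const _)
    (by
      intro n y hy
      have hy' : |y| ≤ r := by simpa using (Metric.mem_ball.1 hy).le
      rcases Nat.eq_zero_or_pos n with rfl | hn
      · simp
      · have hn1 : (1 : ℝ) ≤ n := by exact_mod_cast hn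
        have : ((n : ℝ) * y ^ (n - 1)) / (n : ℝ) ^ (s + 1) = y ^ (n - 1) / (n : ℝ) ^ s := by
          field_simp
          ring
        rw [this, norm_div, norm_pow, norm_pow, Real.norm_eq_abs, Real.norm_natCast]
        calc |y| ^ (n - 1) / (n : ℝ) ^ s ≤ |y| ^ (n - 1) :=
              div_le_self (by positivity) (one_le_pow₀ hn1)
          _ ≤ r ^ (n - 1) := by gcongr)
    (by simpa using (abs_nonneg x).trans_lt hxr)
    (by
      refine summable_of_ne_finset_zero (s := {0}) ?_
      intro n hn
      have : n ≠ 0 := by simpa using hn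
      simp [this])
    (by simpa using hxr)
  have e : plog s x / x = ∑' n : ℕ, ((n : ℝ) * x ^ (n - 1)) / (n : ℝ) ^ (s + 1) := by
    unfold plog
    rw [← tsum_div_const]
    congr 1
    ext n
    rcases Nat.eq_zero_or_pos n with rfl | hn
    · simp [hs]
    · obtain ⟨m, rfl⟩ := Nat.exists_eq_succ_of_ne_zero hn.ne'
      have : ((m.succ : ℕ) : ℝ) ≠ 0 := by positivity
      simp only [Nat.succ_eq_add_one, Nat.add_sub_cancel] at this ⊢
      field_simp
      ring
  rw [e]
  exact key

lemma plog_one (x : ℝ) (hx : |x| < 1) : plog 1 x = - Real.log (1 - x) := by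
  have h := Real.hasSum_pow_div_log_of_abs_lt_one hx
  have h2 : HasSum (fun n : ℕ => x ^ n / (n : ℝ) ^ 1) (- Real.log (1 - x)) := by
    rw [← hasSum_nat_add_iff' 1]
    simpa using h
  exact h2.tsum_eq

lemma plog_zero (s : ℕ) (hs : s ≠ 0) : plog s 0 = 0 := by
  unfold plog
  rw [← tsum_zero (α := ℝ) (β := ℕ)]
  congr 1
  ext n
  rcases Nat.eq_zero_or_pos n with rfl | hn
  · simp [hs]
  · simp [hn.ne']

lemma const_of (f : ℝ → ℝ) (b : ℝ) (hb : 0 < b) (hc : ContinuousOn f (Set.Icc 0 b))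
    (hd : ∀ x ∈ Set.Ioo 0 b, HasDerivAt f 0 x) : f b = f 0 := by
  obtain ⟨c, _, h⟩ := exists_hasDerivAt_eq_slope f (fun _ => 0) hb hc hd
  have : b - 0 ≠ 0 := by linarith
  field_simp at h
  linarith

lemma loglog_cont (b : ℝ) (hb : b < 1) :
    ContinuousOn (fun z : ℝ => Real.log z * Real.log (1 - z)) (Set.Icc 0 b) := by
  have e : (fun z : ℝ => Real.log z * Real.log (1 - z)) =
      fun z => (z * Real.log z) * dslope (fun z => Real.log (1 - z)) 0 z := by
    ext z
    have := sub_smul_dslope (fun z : ℝ => Real.log (1 - z)) 0 z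
    simp at this
    rw [← this]; ring
  rw [e]
  refine Real.continuous_mul_log.continuousOn.mul ?_
  have hd : ∀ z : ℝ, z < 1 → DifferentiableAt ℝ (fun z : ℝ => Real.log (1 - z)) z := by
    intro z hz
    exact DifferentiableAt.log (by fun_prop) (by linarith)
  have := (continuousOn_dslope (f := fun z : ℝ => Real.log (1 - z)) (a := 0)
    (s := Set.Iio 1) (Iio_mem_nhds one_pos)).2
    ⟨fun z hz => (hd z hz).continuousAt.continuousWithinAt, hd 0 one_pos⟩
  exact this.mono (fun z hz => lt_of_le_of_lt hz.2 hb)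

lemma log1_cont (b : ℝ) (hb : b < 1) :
    ContinuousOn (fun z : ℝ => Real.log (1 - z)) (Set.Icc 0 b) := by
  refine ContinuousOn.log (by fun_prop) ?_
  intro z hz
  have := hz.2
  linarith

lemma plog_cont_sub (s : ℕ) (hs : 1 < s) (b : ℝ) (hb : b ≤ 1 / 2) :
    ContinuousOn (fun z : ℝ => plog s (1 - z)) (Set.Icc 0 b) := by
  refine (plog_cont s hs).comp (by fun_prop) ?_
  intro z hz
  have := hz.2
  have := hz.1
  constructor <;> linarith

lemma plog_cont_id (s : ℕ) (hs : 1 < s) (b : ℝ) (hb : b ≤ 1 / 2) :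
    ContinuousOn (fun z : ℝ => plog s z) (Set.Icc 0 b) := by
  refine (plog_cont s hs).mono ?_
  intro z hz
  have := hz.2
  have := hz.1
  constructor <;> linarith

lemma plog_cont_w (s : ℕ) (hs : 1 < s) (b : ℝ) (hb : b ≤ 1 / 2) :
    ContinuousOn (fun z : ℝ => plog s (1 - 1 / (1 - z))) (Set.Icc 0 b) := by
  refine (plog_cont s hs).comp ?_ ?_
  · refine continuousOn_const.sub (continuousOn_const.div (by fun_prop) ?_)
    intro z hz
    have := hz.2
    linarith
  · intro z hz
    have h2 := hz.2
    have h1 := hz.1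
    have h3 : (0 : ℝ) < 1 - z := by linarith
    have h4 : 1 / (1 - z) ≤ 2 := by
      rw [div_le_iff₀ h3]; linarith
    have h5 : 0 ≤ 1 / (1 - z) := by positivity
    constructor <;> linarith

lemma w_bound (z : ℝ) (h0 : 0 < z) (h1 : z < 1 / 2) :
    |1 - 1 / (1 - z)| < 1 ∧ 1 - 1 / (1 - z) ≠ 0 := by
  have h3 : (0 : ℝ) < 1 - z := by linarith
  have h4 : 1 / (1 - z) < 2 := by
    rw [div_lt_iff₀ h3]; linarith
  have h5 : 1 < 1 / (1 - z) := by
    rw [lt_div_iff₀ h3]; linarith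
  exact ⟨abs_lt.2 ⟨by linarith, by linarith⟩, by linarith⟩

lemma d_sub (s : ℕ) (hs : s ≠ 0) (z : ℝ) (h0 : 0 < z) (h1 : z < 1 / 2) :
    HasDerivAt (fun z => plog (s + 1) (1 - z)) (- (plog s (1 - z) / (1 - z))) z := by
  have := (plog_deriv s hs (1 - z) (abs_lt.2 ⟨by linarith, by linarith⟩) (by linarith)).comp z
    ((hasDerivAt_id z).const_sub 1)
  simpa [Function.comp_def] using this

lemma d_id (s : ℕ) (hs : s ≠ 0) (z : ℝ) (h0 : 0 < z) (h1 : z < 1 / 2) :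
    HasDerivAt (fun z => plog (s + 1) z) (plog s z / z) z :=
  plog_deriv s hs z (abs_lt.2 ⟨by linarith, by linarith⟩) (by linarith)

lemma d_w (s : ℕ) (hs : s ≠ 0) (z : ℝ) (h0 : 0 < z) (h1 : z < 1 / 2) :
    HasDerivAt (fun z => plog (s + 1) (1 - 1 / (1 - z)))
      (plog s (1 - 1 / (1 - z)) / (z * (1 - z))) z := by
  have h3 : 1 - z ≠ 0 := by linarith
  have hi := (((hasDerivAt_id z).const_sub 1).inv h3).const_sub 1
  have := (plog_deriv s hs (1 - (1 - z)⁻¹) (by simpa using (w_bound z h0 h1).1)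
    (by simpa using (w_bound z h0 h1).2)).comp z hi
  simp only [one_div]
  refine this.congr_deriv ?_
  have hw : 1 - (1 - z)⁻¹ = -z / (1 - z) := by field_simp; ring
  generalize plog s (1 - (1 - z)⁻¹) = A
  simp only [id]
  rw [hw]
  field_simp

lemma d_log1 (z : ℝ) (h1 : z < 1 / 2) :
    HasDerivAt (fun z : ℝ => Real.log (1 - z)) (-1 / (1 - z)) z :=
  ((hasDerivAt_id z).const_sub 1).log (by simp; linarith)

lemma euler_refl (z : ℝ) (h0 : 0 < z) (h1 : z < 1 / 2) :
    plog 2 z + plog 2 (1 - z) + Real.log z * Real.log (1 - z) = plog 2 1 := by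
  have := const_of (fun z => plog 2 z + plog 2 (1 - z) + Real.log z * Real.log (1 - z)) z h0
    (((plog_cont_id 2 (by norm_num) z h1.le).add (plog_cont_sub 2 (by norm_num) z h1.le)).add
      (loglog_cont z (by linarith)))
    (by
      intro x hx
      have hx0 := hx.1
      have hx1 : x < 1 / 2 := hx.2.trans h1
      refine (((d_id 1 (by norm_num) x hx0 hx1).add (d_sub 1 (by norm_num) x hx0 hx1)).add
        ((Real.hasDerivAt_log hx0.ne').mul (d_log1 x hx1))).congr_deriv ?_
      rw [plog_one x (abs_lt.2 ⟨by linarith, by linarith⟩),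
        plog_one (1 - x) (abs_lt.2 ⟨by linarith, by linarith⟩)]
      have : 1 - x ≠ 0 := by linarith
      rw [sub_sub_cancel]
      field_simp
      ring)
  simpa [plog_zero] using this

lemma landen_two (z : ℝ) (h0 : 0 < z) (h1 : z < 1 / 2) :
    plog 2 z + plog 2 (1 - 1 / (1 - z)) + Real.log (1 - z) ^ 2 / 2 = 0 := by
  have := const_of
    (fun z => plog 2 z + plog 2 (1 - 1 / (1 - z)) + Real.log (1 - z) ^ 2 / 2) z h0
    (((plog_cont_id 2 (by norm_num) z h1.le).add (plog_cont_w 2 (by norm_num) z h1.le)).add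
      (((log1_cont z (by linarith)).pow 2).div_const 2))
    (by
      intro x hx
      have hx0 := hx.1
      have hx1 : x < 1 / 2 := hx.2.trans h1
      refine (((d_id 1 (by norm_num) x hx0 hx1).add (d_w 1 (by norm_num) x hx0 hx1)).add
        (((d_log1 x hx1).pow 2).div_const 2)).congr_deriv ?_
      rw [plog_one x (abs_lt.2 ⟨by linarith, by linarith⟩),
        plog_one _ (w_bound x hx0 hx1).1]
      have : 1 - x ≠ 0 := by linarith
      rw [sub_sub_cancel, one_div, Real.log_inv]
      field_simp
      ring)
  simpa [plog_zero] using this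

lemma landen_three :
    plog 3 (1 / 2) + plog 3 (1 / 2) + plog 3 (-1) - Real.log (1 / 2) ^ 3 / 6
      - plog 2 1 * Real.log (1 / 2) + Real.log (1 / 2) * Real.log (1 / 2) * Real.log (1 / 2) / 2
      = plog 3 1 := by
  have := const_of
    (fun z => plog 3 z + plog 3 (1 - z) + plog 3 (1 - 1 / (1 - z)) - Real.log (1 - z) ^ 3 / 6
      - plog 2 1 * Real.log (1 - z)
      + (Real.log z * Real.log (1 - z)) * Real.log (1 - z) / 2) (1 / 2) (by norm_num)
    ((((((plog_cont_id 3 (by norm_num) _ le_rfl).add (plog_cont_sub 3 (by norm_num) _ le_rfl)).add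
      (plog_cont_w 3 (by norm_num) _ le_rfl)).sub
      (((log1_cont _ (by norm_num)).pow 3).div_const 6)).sub
      (continuousOn_const.mul (log1_cont _ (by norm_num)))).add
      (((loglog_cont _ (by norm_num)).mul (log1_cont _ (by norm_num))).div_const 2))
    (by
      intro x hx
      have hx0 := hx.1
      have hx1 : x < 1 / 2 := hx.2
      refine ((((((d_id 2 (by norm_num) x hx0 hx1).add (d_sub 2 (by norm_num) x hx0 hx1)).add
        (d_w 2 (by norm_num) x hx0 hx1)).sub
        (((d_log1 x hx1).pow 3).div_const 6)).sub
        ((d_log1 x hx1).const_mul _)).add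
        ((((Real.hasDerivAt_log hx0.ne').mul (d_log1 x hx1)).mul
          (d_log1 x hx1)).div_const 2)).congr_deriv ?_
      have e1 := euler_refl x hx0 hx1
      have e2 := landen_two x hx0 hx1
      have e1' : plog 2 (1 - x) = plog 2 1 - Real.log x * Real.log (1 - x) - plog 2 x := by
        linarith
      have e2' : plog 2 (1 - 1 / (1 - x)) = - plog 2 x - Real.log (1 - x) ^ 2 / 2 := by
        linarith
      rw [e1', e2']
      have : 1 - x ≠ 0 := by linarith
      simp only [Pi.mul_apply]
      field_simp
      ring)
  norm_num [plog_zero] at this ⊢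
  linarith

lemma odd_term (k : ℕ) : ((-1 : ℝ) ^ (2 * k + 1) / ((2 * k + 1 : ℕ) : ℝ) ^ 3
    + (1 : ℝ) ^ (2 * k + 1) / ((2 * k + 1 : ℕ) : ℝ) ^ 3) = 0 := by
  have : (-1 : ℝ) ^ (2 * k + 1) = -1 := Odd.neg_one_pow ⟨k, rfl⟩
  rw [this, one_pow, neg_div, neg_add_cancel]

lemma even_term (k : ℕ) : ((-1 : ℝ) ^ (2 * k) / ((2 * k : ℕ) : ℝ) ^ 3
    + (1 : ℝ) ^ (2 * k) / ((2 * k : ℕ) : ℝ) ^ 3) = (1 / 4) * ((1 : ℝ) ^ k / (k : ℝ) ^ 3) := by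
  have : (-1 : ℝ) ^ (2 * k) = 1 := Even.neg_one_pow ⟨k, two_mul k⟩
  rw [this, one_pow, one_pow, Nat.cast_mul, mul_pow, ← div_div]
  norm_num
  ring

lemma tsum_split (f : ℕ → ℝ) (hf : Summable f) :
    ∑' k : ℕ, f (2 * k) + ∑' k : ℕ, f (2 * k + 1) = ∑' n : ℕ, f n := by
  have i1 : Function.Injective (fun k : ℕ => 2 * k) := by
    intro a b hab
    simp only at hab
    omega
  have i2 : Function.Injective (fun k : ℕ => 2 * k + 1) := by
    intro a b hab
    simp only at hab
    omega
  exact tsum_even_add_odd (hf.comp_injective i1) (hf.comp_injective i2)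

lemma plog_neg_one : plog 3 (-1) = -(3 / 4) * plog 3 1 := by
  have s1 : Summable (fun n : ℕ => (-1 : ℝ) ^ n / (n : ℝ) ^ 3) :=
    plog_summable 3 (by norm_num) (-1) (by simp)
  have s2 : Summable (fun n : ℕ => (1 : ℝ) ^ n / (n : ℝ) ^ 3) :=
    plog_summable 3 (by norm_num) 1 (by simp)
  have hs : Summable (fun n : ℕ => (-1 : ℝ) ^ n / (n : ℝ) ^ 3 + (1 : ℝ) ^ n / (n : ℝ) ^ 3) :=
    s1.add s2
  have h : plog 3 (-1) + plog 3 1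
      = ∑' n : ℕ, ((-1 : ℝ) ^ n / (n : ℝ) ^ 3 + (1 : ℝ) ^ n / (n : ℝ) ^ 3) := by
    unfold plog
    rw [s1.tsum_add s2]
  have h2 := tsum_split _ hs
  rw [← h] at h2
  rw [tsum_congr odd_term, tsum_congr even_term, tsum_zero, tsum_mul_left] at h2
  have h3 : plog 3 1 = ∑' k : ℕ, (1 : ℝ) ^ k / (k : ℝ) ^ 3 := by
    unfold plog
    rfl
  rw [← h3] at h2
  linarith

theorem landen_trilog :
    ∑' n : ℕ, (1/2 : ℝ) ^ n / (n : ℝ) ^ 3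
      = (7/8) * (∑' n : ℕ, 1 / (n : ℝ) ^ 3)
        - (1/2) * (∑' n : ℕ, 1 / (n : ℝ) ^ 2) * Real.log 2
        + (Real.log 2) ^ 3 / 6 := by
  have h := landen_three
  rw [plog_neg_one] at h
  have hl : Real.log (1 / 2) = - Real.log 2 := by rw [one_div, Real.log_inv]
  rw [hl] at h
  have a : ∀ s : ℕ, plog s 1 = ∑' n : ℕ, 1 / (n : ℝ) ^ s := by
    intro s
    simp [plog]
  rw [← a, ← a]
  change plog 3 (1 / 2) = _
  linarith
end

section
/- δ_{2,1} = ζ(3)/8 - (ln 2)³/6, where δ_{2,1} = ∑_{n>m≥1} (1/2)ⁿ/(n²m). -/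
noncomputable def deltaD (s t : ℕ) : ℝ :=
  ∑' n : ℕ, ∑' m : ℕ,
    if 0 < m ∧ m < n then (1/2 : ℝ) ^ n / ((n : ℝ) ^ s * (m : ℝ) ^ t) else 0

open Finset

noncomputable def hh (n : ℕ) : ℝ := ∑ m ∈ range n, 1 / (m : ℝ)
noncomputable def aa (p : ℕ × ℕ) : ℝ := 1 / ((p.1 : ℝ) * p.2 * (p.1 + p.2))

lemma hh_succ (n : ℕ) : hh (n+1) = hh n + 1 / (n:ℝ) := by simp [hh, sum_range_succ]

lemma hh_nonneg (n : ℕ) : 0 ≤ hh n := by unfold hh; positivity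

lemma hh_le (n : ℕ) : hh n ≤ n := by
  unfold hh
  calc _ ≤ ∑ m ∈ range n, (1:ℝ) := by
        apply sum_le_sum
        intro m _
        rcases Nat.eq_zero_or_pos m with rfl | h
        · simp
        · rw [div_le_one (by positivity)]; exact_mod_cast h
    _ = n := by simp

lemma aa_nonneg (p : ℕ × ℕ) : 0 ≤ aa p := by unfold aa; positivity

lemma aa_summable : Summable aa := by
  have h : Summable (fun n : ℕ => 1 / (n:ℝ) ^ (3/2 : ℝ)) :=
    Real.summable_one_div_nat_rpow.2 (by norm_num)
  have h2 := h.mul_of_nonneg h (fun n => by positivity) (fun n => by positivity)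
  refine Summable.of_nonneg_of_le aa_nonneg ?_ h2
  rintro ⟨n, k⟩
  simp only [aa]
  rcases Nat.eq_zero_or_pos n with rfl | hn
  · simp
  rcases Nat.eq_zero_or_pos k with rfl | hk
  · simp
  have hn' : (0:ℝ) < n := by exact_mod_cast hn
  have hk' : (0:ℝ) < k := by exact_mod_cast hk
  have e : ∀ x : ℝ, 0 < x → x ^ (3/2:ℝ) = x * √x := by
    intro x hx
    rw [Real.sqrt_eq_rpow, ← Real.rpow_one_add' hx.le (by norm_num)]; norm_num
  rw [e _ hn', e _ hk', one_div_mul_one_div_rev]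
  apply one_div_le_one_div_of_le (by positivity)
  have s1 := Real.sq_sqrt hn'.le
  have s2 := Real.sq_sqrt hk'.le
  have : √(n:ℝ) * √k ≤ n + k := by nlinarith [sq_nonneg (√(n:ℝ) - √k), Real.sqrt_nonneg (n:ℝ), Real.sqrt_nonneg (k:ℝ)]
  calc _ = (n:ℝ) * k * (√(n:ℝ) * √k) := by ring
    _ ≤ _ := by gcongr

lemma antidiag (N : ℕ) :
    ∑ p ∈ antidiagonal N, 1 / ((p.1:ℝ) * p.2) = 2 * hh N / N := by
  rcases Nat.eq_zero_or_pos N with rfl | hN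
  · simp
  have hN' : (0:ℝ) < N := by exact_mod_cast hN
  rw [Finset.Nat.sum_antidiagonal_eq_sum_range_succ (fun i j => 1 / ((i:ℝ) * j))]
  rw [sum_range_succ]
  simp only [Nat.sub_self, Nat.cast_zero, mul_zero, div_zero, add_zero]
  have h2 : hh N = ∑ m ∈ range N, if m = 0 then 0 else 1 / ((N - m : ℕ):ℝ) := by
    obtain ⟨M, rfl⟩ : ∃ M, N = M + 1 := ⟨N - 1, by omega⟩
    unfold hh
    rw [sum_range_succ', sum_range_succ']
    simp only [Nat.cast_zero, div_zero, add_zero, if_true]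
    rw [← sum_range_reflect]
    apply sum_congr rfl
    intro j hj
    have := mem_range.1 hj
    rw [if_neg (by omega), show M - 1 - j + 1 = M + 1 - (j + 1) by omega]
  rw [two_mul, add_div]
  nth_rewrite 2 [h2]
  unfold hh
  rw [sum_div, sum_div, ← sum_add_distrib]
  apply sum_congr rfl
  intro m hm
  have := mem_range.1 hm
  split_ifs with h
  · subst h; simp
  · have : (0:ℝ) < m := by positivity
    have h3 : ((N - m : ℕ):ℝ) = N - m := by push_cast [mem_range.1 hm |>.le]; ring
    have h4 : (0:ℝ) < ((N - m : ℕ):ℝ) := by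
      have : 0 < N - m := by omega
      exact_mod_cast this
    rw [h3] at h4 ⊢
    field_simp
    ring

lemma hasSum_tele (n : ℕ) :
    HasSum (fun j : ℕ => 1 / ((j:ℝ)+1) - 1 / ((n:ℝ)+j+1)) (hh (n+1)) := by
  induction n with
  | zero => simp [hh]
  | succ n ih =>
    rw [hh_succ]
    have h : HasSum (fun j : ℕ => 1 / ((n:ℝ)+j+1) - 1 / ((n:ℝ)+(j+1:ℕ)+1)) (1 / ((n+1:ℕ):ℝ)) := by
      rw [hasSum_iff_tendsto_nat_of_nonneg]
      · have : ∀ m : ℕ, ∑ j ∈ range m, (1 / ((n:ℝ)+j+1) - 1 / ((n:ℝ)+(j+1:ℕ)+1))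
            = 1 / ((n+1:ℕ):ℝ) - 1 / ((n:ℝ)+m+1) := by
          intro m
          rw [sum_range_sub' (fun j : ℕ => 1 / ((n:ℝ)+j+1))]; simp
        simp only [this]
        have t : Filter.Tendsto (fun m : ℕ => 1 / ((n:ℝ)+m+1)) Filter.atTop (nhds 0) := by
          have := (tendsto_one_div_add_atTop_nhds_zero_nat (𝕜 := ℝ)).comp (Filter.tendsto_add_atTop_nat n)
          refine this.congr ?_
          intro m
          simp [add_comm]
        simpa using tendsto_const_nhds.sub t
      · intro j
        rw [sub_nonneg]
        apply one_div_le_one_div_of_le (by positivity)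
        push_cast; linarith
    refine (ih.add h).congr_fun ?_ 
    intro j
    push_cast
    ring

lemma inner (n : ℕ) : HasSum (fun k : ℕ => aa (n, k)) (hh (n+1) / (n:ℝ)^2) := by
  rcases Nat.eq_zero_or_pos n with rfl | hn
  · simp [aa]
  have hn' : (0:ℝ) < n := by exact_mod_cast hn
  rw [← hasSum_nat_add_iff' 1]
  have := (hasSum_tele n).div_const ((n:ℝ)^2)
  have h0 : aa (n, 0) = 0 := by simp [aa]
  rw [sum_range_one, h0, sub_zero]
  refine this.congr_fun (fun j => ?_)
  simp only [aa]
  push_cast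
  field_simp
  ring

lemma sum_left (w : ℕ → ℝ) (hw : ∀ n, |w n| ≤ 1) :
    HasSum (fun n => w n * (hh (n+1) / (n:ℝ)^2)) (∑' p : ℕ × ℕ, w p.1 * aa p) := by
  have hs : Summable (fun p : ℕ × ℕ => w p.1 * aa p) := by
    refine Summable.of_norm_bounded aa_summable ?_
    intro p
    rw [norm_mul, Real.norm_eq_abs, Real.norm_of_nonneg (aa_nonneg p)]
    exact mul_le_of_le_one_left (aa_nonneg p) (hw _)
  exact hs.hasSum.prod_fiberwise (fun n => (inner n).mul_left (w n))

lemma sum_diag (w : ℕ → ℝ) (hw : ∀ n, |w n| ≤ 1) :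
    HasSum (fun n => w n * (2 * (hh n / (n:ℝ)^2))) (∑' p : ℕ × ℕ, w (p.1 + p.2) * aa p) := by
  have hs : Summable (fun p : ℕ × ℕ => w (p.1 + p.2) * aa p) := by
    refine Summable.of_norm_bounded aa_summable ?_
    intro p
    rw [norm_mul, Real.norm_eq_abs, Real.norm_of_nonneg (aa_nonneg p)]
    exact mul_le_of_le_one_left (aa_nonneg p) (hw _)
  have h1 := (Finset.HasAntidiagonal.sigmaAntidiagonalEquivProd (A := ℕ)).hasSum_iff.2 hs.hasSum
  refine h1.sigma (fun N => ?_)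
  have h2 := hasSum_fintype (fun p : antidiagonal N => w (p.1.1 + p.1.2) * aa p.1)
  suffices hq : ∑ p : antidiagonal N, w (p.1.1 + p.1.2) * aa p.1 = w N * (2 * (hh N / (N:ℝ)^2)) by
    rw [hq] at h2
    exact h2
  rw [Finset.sum_coe_sort (antidiagonal N) (fun p => w (p.1 + p.2) * aa p)]
  have : ∀ p ∈ antidiagonal N, w (p.1 + p.2) * aa p = w N / N * (1 / ((p.1:ℝ) * p.2)) := by
    intro p hp
    have := mem_antidiagonal.1 hp
    rw [this, aa, ← this]
    push_cast
    rw [one_div, mul_inv, one_div]; ring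
  rw [sum_congr rfl this, ← mul_sum, antidiag]
  ring

lemma c_summable : Summable (fun n => hh n / (n:ℝ)^2) := by
  have := (sum_diag (fun _ => 1) (by simp)).summable
  refine (this.mul_left (1/2)).congr (fun n => ?_)
  ring

lemma z_summable : Summable (fun n : ℕ => 1 / (n:ℝ)^3) :=
  Real.summable_one_div_nat_pow.2 (by norm_num)

lemma left_eq (w : ℕ → ℝ) (hw : ∀ n, |w n| ≤ 1) :
    ∑' p : ℕ × ℕ, w p.1 * aa p = ∑' n, w n * (hh n / (n:ℝ)^2) + ∑' n : ℕ, w n * (1 / (n:ℝ)^3) := by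
  rw [← (sum_left w hw).tsum_eq, ← Summable.tsum_add]
  · congr 1; ext n
    rw [hh_succ, ← mul_add]
    congr 1
    rcases Nat.eq_zero_or_pos n with rfl | hn
    · simp
    have hn' : (0:ℝ) < n := by exact_mod_cast hn
    field_simp
  · refine Summable.of_norm_bounded c_summable (fun n => ?_)
    have : 0 ≤ hh n / (n:ℝ)^2 := div_nonneg (hh_nonneg n) (by positivity)
    rw [norm_mul, Real.norm_eq_abs, Real.norm_of_nonneg this]
    exact mul_le_of_le_one_left this (hw _)
  · refine Summable.of_norm_bounded z_summable (fun n => ?_)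
    have : 0 ≤ 1 / (n:ℝ)^3 := by positivity
    rw [norm_mul, Real.norm_eq_abs, Real.norm_of_nonneg this]
    exact mul_le_of_le_one_left this (hw _)

lemma diag_eq (w : ℕ → ℝ) (hw : ∀ n, |w n| ≤ 1) :
    ∑' p : ℕ × ℕ, w (p.1 + p.2) * aa p = 2 * ∑' n, w n * (hh n / (n:ℝ)^2) := by
  rw [← (sum_diag w hw).tsum_eq, ← tsum_mul_left]
  congr 1; ext n; ring

lemma one_add_sgn (n : ℕ) (h : ¬ Even n) : (1 + (-1:ℝ)^n) = 0 := by
  rw [Nat.not_even_iff_odd] at h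
  rw [h.neg_one_pow]; norm_num

lemma A_eq : ∑' n : ℕ, (-1:ℝ)^n * (1 / (n:ℝ)^3) = -(3/4) * ∑' n : ℕ, 1 / (n:ℝ)^3 := by
  have hs : Summable (fun n : ℕ => (-1:ℝ)^n * (1 / (n:ℝ)^3)) := by
    refine Summable.of_norm_bounded z_summable (fun n => ?_)
    simp
  have h1 := z_summable.tsum_add hs
  have h2 : ∑' n : ℕ, (1 / (n:ℝ)^3 + (-1:ℝ)^n * (1 / (n:ℝ)^3)) = 1/4 * ∑' n : ℕ, 1 / (n:ℝ)^3 := by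
    rw [← tsum_mul_left]
    have inj : Function.Injective (fun n : ℕ => 2 * n) := fun a b h => by simpa using h
    rw [← inj.tsum_eq]
    · congr 1; ext n; simp; ring
    · intro n hn
      by_contra hc
      apply hn
      have : ¬ Even n := fun ⟨m, hm⟩ => hc ⟨m, by simp; omega⟩
      have := one_add_sgn n this
      linear_combination (1 / (n:ℝ)^3) * this
  linarith

lemma T_neg_one : ∑' n : ℕ, (-1:ℝ)^n * (hh n / (n:ℝ)^2) = (∑' n : ℕ, 1 / (n:ℝ)^3) / 8 := by
  have b1 : ∀ n : ℕ, |(-1:ℝ)^n| ≤ 1 := by simp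
  have l1 := left_eq (fun _ => 1) (by simp)
  have d1 := diag_eq (fun _ => 1) (by simp)
  have l2 := left_eq (fun n => (-1)^n) b1
  have d2 := diag_eq (fun n => (-1)^n) b1
  have A := A_eq
  simp only [one_mul] at l1 d1
  have su : ∀ v : ℕ × ℕ → ℝ, (∀ p, |v p| ≤ 1) → Summable (fun p => v p * aa p) := by
    intro v hv
    refine Summable.of_norm_bounded aa_summable ?_
    intro p
    rw [norm_mul, Real.norm_eq_abs, Real.norm_of_nonneg (aa_nonneg p)]
    exact mul_le_of_le_one_left (aa_nonneg p) (hv _)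
  have s1 := su (fun p => (-1)^p.1) (by simp)
  have s2 := su (fun p => (-1)^p.2) (by simp)
  have s3 := su (fun p => (-1)^(p.1+p.2)) (by simp)
  have sw : ∑' p : ℕ × ℕ, (-1:ℝ)^p.2 * aa p = ∑' p : ℕ × ℕ, (-1:ℝ)^p.1 * aa p := by
    rw [← (Equiv.prodComm ℕ ℕ).tsum_eq]
    congr 1; ext p; simp [aa]; ring
  have tot := (aa_summable.hasSum.add s3.hasSum).add (s1.hasSum.add s2.hasSum)
  have ev : ∑' p : ℕ × ℕ, (aa p + (-1:ℝ)^(p.1+p.2) * aa p + ((-1:ℝ)^p.1 * aa p + (-1:ℝ)^p.2 * aa p))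
      = 1/2 * ∑' p, aa p := by
    rw [← tsum_mul_left]
    have inj : Function.Injective (fun p : ℕ × ℕ => (2 * p.1, 2 * p.2)) := by
      rintro ⟨a, b⟩ ⟨c, d⟩ h
      simpa using h
    rw [← inj.tsum_eq]
    · congr 1; ext p
      have : (aa (2 * p.1, 2 * p.2)) = 1/8 * aa p := by
        simp only [aa]; push_cast
        rw [show (2 * (p.1:ℝ) * (2 * p.2) * (2 * p.1 + 2 * p.2)) = 8 * (p.1 * p.2 * (p.1 + p.2)) by ring]
        rw [one_div_mul_one_div]
      simp only [this, pow_add, pow_mul]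
      norm_num
      ring
    · rintro ⟨n, k⟩ hn
      by_contra hc
      apply hn
      have e : (1 + (-1:ℝ)^n) * (1 + (-1:ℝ)^k) = 0 := by
        by_cases h1 : Even n
        · have : ¬ Even k := by
            intro ⟨m, hm⟩
            obtain ⟨l, hl⟩ := h1
            exact hc ⟨(l, m), by simp; omega⟩
          rw [one_add_sgn k this, mul_zero]
        · rw [one_add_sgn n h1, zero_mul]
      simp only [pow_add]
      linear_combination aa (n, k) * e
  rw [tot.tsum_eq] at ev
  linarith

noncomputable def TT (x : ℝ) : ℝ := ∑' n : ℕ, x^n * (hh n / (n:ℝ)^2)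

lemma c_nonneg (n : ℕ) : 0 ≤ hh n / (n:ℝ)^2 := div_nonneg (hh_nonneg n) (by positivity)

lemma TT_cont : ContinuousOn TT (Set.Icc (-1) 1) := by
  unfold TT
  refine continuousOn_tsum (fun n => by fun_prop) c_summable (fun n x hx => ?_)
  rw [norm_mul, Real.norm_of_nonneg (c_nonneg n), norm_pow, Real.norm_eq_abs]
  exact mul_le_of_le_one_left (c_nonneg n) (pow_le_one₀ (abs_nonneg _) (abs_le.2 hx))

lemma log_sq {x : ℝ} (hx : |x| < 1) :
    ∑' n : ℕ, x^n * (hh n / n) = (Real.log (1 - x))^2 / 2 := by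
  have h1 : HasSum (fun n : ℕ => x^n / (n:ℝ)) (-Real.log (1 - x)) := by
    rw [← hasSum_nat_add_iff' 1]
    simpa using Real.hasSum_pow_div_log_of_abs_lt_one hx
  have h2 : Summable (fun n : ℕ => ‖x^n / (n:ℝ)‖) := h1.summable.norm
  have h3 := tsum_mul_tsum_eq_tsum_sum_antidiagonal_of_summable_norm h2 h2
  rw [h1.tsum_eq] at h3
  have h4 : ∀ N : ℕ, ∑ p ∈ antidiagonal N, x^p.1 / (p.1:ℝ) * (x^p.2 / (p.2:ℝ))
      = 2 * (x^N * (hh N / N)) := by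
    intro N
    have : ∀ p ∈ antidiagonal N, x^p.1 / (p.1:ℝ) * (x^p.2 / (p.2:ℝ)) = x^N * (1 / ((p.1:ℝ) * p.2)) := by
      intro p hp
      rw [← mem_antidiagonal.1 hp, pow_add, div_mul_div_comm, mul_one_div]
    rw [sum_congr rfl this, ← mul_sum, antidiag]
    ring
  simp only [h4] at h3
  rw [tsum_mul_left] at h3
  linarith

lemma TT_deriv {x : ℝ} (hx : |x| < 1) (hx0 : x ≠ 0) :
    HasDerivAt TT ((Real.log (1 - x))^2 / 2 / x) x := by
  obtain ⟨r, hr, hr1⟩ := exists_between hx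
  have hr0 : 0 < r := (abs_nonneg x).trans_lt hr
  have hu : Summable (fun n : ℕ => r^(n-1)) := by
    rw [← summable_nat_add_iff 1]
    simpa using summable_geometric_of_lt_one hr0.le hr1
  have key := hasDerivAt_tsum_of_isPreconnected (g := fun (n:ℕ) (x:ℝ) => x^n * (hh n / (n:ℝ)^2))
    (g' := fun (n:ℕ) (x:ℝ) => ((n:ℝ) * x^(n-1)) * (hh n / (n:ℝ)^2)) (t := Metric.ball 0 r)
    (y₀ := 0) (y := x) hu Metric.isOpen_ball
    (convex_ball (0:ℝ) r).isPreconnected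
    (fun n y _ => (hasDerivAt_pow n y).mul_const _) ?_ (by simpa using hr0) ?_ (by simpa using hr)
  · refine HasDerivAt.congr_deriv (f := TT) key ?_
    symm
    rw [← log_sq hx, ← tsum_div_const]
    congr 1; ext n
    rcases Nat.eq_zero_or_pos n with rfl | hn
    · simp
    have hn' : (0:ℝ) < n := by exact_mod_cast hn
    obtain ⟨m, rfl⟩ : ∃ m, n = m + 1 := ⟨n - 1, by omega⟩
    simp only [Nat.add_sub_cancel, pow_succ x]
    field_simp
  · intro n y hy
    have hy' : |y| < r := by simpa using hy
    rcases Nat.eq_zero_or_pos n with rfl | hn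
    · simp
    have hn' : (0:ℝ) < n := by exact_mod_cast hn
    have e : ((n:ℝ) * y^(n-1)) * (hh n / (n:ℝ)^2) = y^(n-1) * (hh n / n) := by field_simp
    have q0 : 0 ≤ hh n / n := div_nonneg (hh_nonneg n) hn'.le
    have q1 : hh n / n ≤ 1 := by rw [div_le_one hn']; exact hh_le n
    rw [e, norm_mul, norm_pow, Real.norm_eq_abs, Real.norm_of_nonneg q0]
    calc _ ≤ |y|^(n-1) * 1 := by gcongr
      _ ≤ r^(n-1) := by rw [mul_one]; gcongr
  · refine Summable.of_norm_bounded c_summable (fun n => ?_)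
    rw [norm_mul, Real.norm_of_nonneg (c_nonneg n), norm_pow]
    exact mul_le_of_le_one_left (c_nonneg n) (pow_le_one₀ (by simp) (by simp))

lemma TT_half : TT (1/2) = TT (-1) - (Real.log 2)^3 / 6 := by
  have h := exists_hasDerivAt_eq_slope
    (fun u : ℝ => TT (u / (1+u)) - TT (-u) + (Real.log (1+u))^3 / 6) (fun _ => 0)
    (a := 0) (b := 1) one_pos ?_ ?_
  · obtain ⟨c, _, hc⟩ := h
    norm_num at hc
    norm_num
    linarith
  · refine ContinuousOn.add (ContinuousOn.sub ?_ ?_) ?_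
    · refine TT_cont.comp (f := fun u : ℝ => u / (1+u)) ?_ ?_
      · refine ContinuousOn.div (by fun_prop) (by fun_prop) ?_
        intro u hu; have := hu.1; positivity
      · intro u hu
        have h0 := hu.1
        have : 0 ≤ u / (1+u) := by positivity
        refine ⟨by linarith, ?_⟩
        rw [div_le_one (by positivity)]; linarith
    · refine TT_cont.comp (f := fun u : ℝ => -u) (by fun_prop) ?_
      intro u hu
      have h0 := hu.1
      have h1 := hu.2
      constructor <;> linarith
    · refine ContinuousOn.div_const (ContinuousOn.pow (ContinuousOn.log (by fun_prop) ?_) 3) 6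
      intro u hu; have := hu.1; positivity
  · intro u hu
    have h0 := hu.1
    have h1 := hu.2
    have hp : 0 < 1 + u := by linarith
    have v0 : 0 < u / (1+u) := by positivity
    have v1 : u / (1+u) < 1 := by rw [div_lt_one hp]; linarith
    have d1 := TT_deriv (x := u / (1+u)) (by rw [abs_of_pos v0]; exact v1) v0.ne'
    have d2 := TT_deriv (x := -u) (by rw [abs_neg, abs_of_pos h0]; exact h1) (by simpa using h0.ne')
    have e1 : Real.log (1 - u / (1+u)) = - Real.log (1+u) := by
      rw [← Real.log_inv]; congr 1; field_simp; ring
    rw [e1] at d1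
    rw [sub_neg_eq_add] at d2
    have da : HasDerivAt (fun u : ℝ => 1 + u) 1 u := by simpa using (hasDerivAt_id u).const_add 1
    have dq := (hasDerivAt_id u).div da hp.ne'
    have dn := (hasDerivAt_id u).neg
    have dl := ((da.log hp.ne').pow 3).div_const 6
    have D := ((d1.comp u dq).sub (d2.comp u dn)).add dl
    refine D.congr_deriv ?_
    simp only [id]
    field_simp
    ring

theorem delta_2_1 :
    deltaD 2 1 = (∑' n : ℕ, 1 / (n : ℝ) ^ 3) / 8 - (Real.log 2) ^ 3 / 6 := by
  rw [← T_neg_one]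
  refine Eq.trans ?_ TT_half
  unfold deltaD TT
  congr 1; ext n
  rw [tsum_eq_sum (s := range n)]
  · unfold hh
    rw [sum_div, mul_sum]
    apply sum_congr rfl
    intro m hm
    have := mem_range.1 hm
    rcases Nat.eq_zero_or_pos m with rfl | h
    · simp
    · rw [if_pos ⟨h, this⟩]
      field_simp
  · intro m hm
    rw [if_neg]
    simp at hm
    omega
end

section
/- δ_{1,2} = (ζ(2)·ln 2)/2 - (ln 2)³/6 - ζ(3)/4, where δ_{1,2} = ∑_{n>m≥1} (1/2)ⁿ/(n·m²). Equivalently, δ₂·ln 2 = 2·δ_{2,1} + δ_{1,2}. -/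
open Set Filter Topology

/-- Power series with coefficients `a`. -/
noncomputable def PS (a : ℕ → ℝ) (x : ℝ) : ℝ := ∑' n : ℕ, a n * x ^ n

/-- Truncated zeta sums. -/
noncomputable def HS (t n : ℕ) : ℝ := ∑ m ∈ Finset.range n, 1 / (m : ℝ) ^ t

/-- The polylogarithm. -/
noncomputable def LiS (s : ℕ) : ℝ → ℝ := PS (fun n => 1 / (n : ℝ) ^ s)

lemma PS_summable (b : ℕ → ℝ) (hb : ∀ n, |b n| ≤ n) {x : ℝ} (hx : |x| < 1) :
    Summable (fun n => b n * x ^ n) := by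
  have h := summable_pow_mul_geometric_of_norm_lt_one (R := ℝ) 1 (r := |x|) (by simpa using hx)
  refine Summable.of_norm_bounded h (fun n => ?_)
  rw [Real.norm_eq_abs, abs_mul, abs_pow, pow_one]
  exact mul_le_mul_of_nonneg_right (hb n) (by positivity)

lemma PS_deriv' (a b : ℕ → ℝ) (hab : ∀ n, a n * n = b n) (hb : ∀ n, |b n| ≤ n)
    {x : ℝ} (hx : |x| < 1) :
    HasDerivAt (PS a) (∑' n : ℕ, b n * x ^ (n - 1)) x := by
  obtain ⟨r, hxr, hr1⟩ := exists_between hx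
  have hr0 : 0 < r := lt_of_le_of_lt (abs_nonneg x) hxr
  have hs := summable_pow_mul_geometric_of_norm_lt_one (R := ℝ) 1 (r := r)
    (by rw [Real.norm_eq_abs, abs_of_pos hr0]; exact hr1)
  have hs' : Summable (fun n : ℕ => (n : ℝ) * r ^ (n - 1)) := by
    refine (hs.mul_right r⁻¹).congr (fun n => ?_)
    rcases n with _ | n
    · simp
    · simp only [Nat.add_sub_cancel, pow_succ]
      field_simp
  refine hasDerivAt_tsum_of_isPreconnected (u := fun n : ℕ => (n : ℝ) * r ^ (n - 1))
    (t := Ioo (-r) r) (y₀ := 0) (g := fun n z => a n * z ^ n)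
    (g' := fun n z => b n * z ^ (n - 1)) hs' isOpen_Ioo isPreconnected_Ioo ?_ ?_ ?_ ?_ ?_
  · intro n y _
    have := (hasDerivAt_pow n y).const_mul (a n)
    rw [← hab n, mul_assoc]
    exact this
  · intro n y hy
    rw [Real.norm_eq_abs, abs_mul, abs_pow]
    have : |y| ≤ r := (abs_lt.2 hy).le
    gcongr
    exact hb n
  · exact ⟨by linarith, hr0⟩
  · refine summable_of_ne_finset_zero (s := {0}) (fun n hn => ?_)
    have : n ≠ 0 := by simpa using hn
    simp [this]
  · exact abs_lt.1 hxr

lemma PS_deriv (a b : ℕ → ℝ) (hab : ∀ n, a n * n = b n) (hb : ∀ n, |b n| ≤ n)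
    {x : ℝ} (hx : |x| < 1) (hx0 : x ≠ 0) :
    HasDerivAt (PS a) (PS b x / x) x := by
  convert PS_deriv' a b hab hb hx using 1
  rw [PS, ← tsum_div_const]
  congr 1
  ext n
  rcases n with _ | n
  · have : b 0 = 0 := by simpa using hb 0
    simp [this]
  · simp only [Nat.add_sub_cancel, pow_succ]
    field_simp

lemma PS_zero (a : ℕ → ℝ) : PS a 0 = a 0 := by
  rw [PS, tsum_eq_single 0]
  · simp
  · intro n hn
    simp [hn]

lemma HS_nonneg (t n : ℕ) : 0 ≤ HS t n := Finset.sum_nonneg (fun _ _ => by positivity)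

lemma one_div_pow_le (t m : ℕ) : 1 / (m : ℝ) ^ t ≤ 1 := by
  rcases Nat.eq_zero_or_pos m with h | h
  · subst h
    rcases t with _ | t <;> simp
  · have : (1 : ℝ) ≤ m := by exact_mod_cast h
    rw [div_le_one (by positivity)]
    exact one_le_pow₀ this

lemma HS_le (t n : ℕ) : HS t n ≤ n := by
  calc HS t n ≤ ∑ m ∈ Finset.range n, (1 : ℝ) :=
        Finset.sum_le_sum (fun m _ => one_div_pow_le t m)
    _ = n := by simp

lemma HS_abs (t n : ℕ) : |HS t n| ≤ n := by
  rw [abs_of_nonneg (HS_nonneg t n)]; exact HS_le t n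

lemma Li_abs (s n : ℕ) (hs : s ≠ 0) : |1 / (n : ℝ) ^ s| ≤ n := by
  rw [abs_of_nonneg (by positivity)]
  rcases Nat.eq_zero_or_pos n with h | h
  · subst h; simp [hs]
  · exact (one_div_pow_le s n).trans (by exact_mod_cast h)

lemma PS_HS (t : ℕ) (ht : t ≠ 0) {x : ℝ} (hx : |x| < 1) :
    PS (HS t) x = x * LiS t x / (1 - x) := by
  have h1 := PS_summable (HS t) (HS_abs t) hx
  have h2 := PS_summable (fun n => 1 / (n : ℝ) ^ t) (fun n => Li_abs t n ht) hx
  have h3 : PS (HS t) x = x * (PS (HS t) x + LiS t x) := by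
    conv_lhs => rw [PS, h1.tsum_eq_zero_add]
    rw [LiS, PS, PS, ← h1.tsum_add h2, ← tsum_mul_left]
    simp only [HS, Finset.range_zero, Finset.sum_empty, zero_mul, zero_add]
    congr 1
    ext n
    rw [Finset.sum_range_succ]
    ring
  have h4 : (1 - x) ≠ 0 := by
    have := (abs_lt.1 hx).2
    linarith
  rw [eq_div_iff h4]
  linarith

lemma Li1_eq {x : ℝ} (hx : |x| < 1) : LiS 1 x = -Real.log (1 - x) := by
  rw [← (Real.hasSum_pow_div_log_of_abs_lt_one hx).tsum_eq, LiS, PS,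
    (PS_summable _ (fun n => Li_abs 1 n one_ne_zero) hx).tsum_eq_zero_add]
  simp [div_eq_inv_mul]

lemma Li_deriv (s : ℕ) (hs : s ≠ 0) {x : ℝ} (hx : |x| < 1) (hx0 : x ≠ 0) :
    HasDerivAt (LiS (s + 1)) (LiS s x / x) x := by
  refine PS_deriv _ _ (fun n => ?_) (fun n => Li_abs s n hs) hx hx0
  rcases Nat.eq_zero_or_pos n with h | h
  · subst h; simp [hs]
  · rw [pow_succ]; field_simp

lemma Li2_deriv {x : ℝ} (hx : |x| < 1) (hx0 : x ≠ 0) :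
    HasDerivAt (LiS 2) (-Real.log (1 - x) / x) x := by
  rw [← Li1_eq hx]; exact Li_deriv 1 one_ne_zero hx hx0

lemma Li_cont (s : ℕ) (hs : 1 < s) : ContinuousOn (LiS s) (Icc (-1) 1) := by
  refine continuousOn_tsum (u := fun n : ℕ => 1 / (n : ℝ) ^ s)
    (fun n => by fun_prop) (Real.summable_one_div_nat_pow.2 hs) (fun n x hx => ?_)
  rw [Real.norm_eq_abs, abs_mul, abs_pow, abs_of_nonneg (by positivity : 0 ≤ 1 / (n : ℝ) ^ s)]
  exact mul_le_of_le_one_right (by positivity) (pow_le_one₀ (abs_nonneg x) (abs_le.2 hx))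

lemma Li_zero (s : ℕ) (hs : s ≠ 0) : LiS s 0 = 0 := by
  rw [LiS, PS_zero]; simp [hs]

/-- Coefficients of `Li_{1,t}`, `Li_{2,1}`. -/
noncomputable def DL (s t : ℕ) : ℝ → ℝ := PS (fun n => HS t n / (n : ℝ) ^ s)

lemma DL_zero (s t : ℕ) : DL s t 0 = 0 := by
  rw [DL, PS_zero]; simp [HS]

lemma HSdiv_abs (s t n : ℕ) : |HS t n / (n : ℝ) ^ s| ≤ n := by
  rw [abs_of_nonneg (div_nonneg (HS_nonneg _ _) (by positivity)), div_eq_mul_one_div]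
  exact (mul_le_of_le_one_right (HS_nonneg _ _) (one_div_pow_le s n)).trans (HS_le t n)

lemma DL_coef (s t n : ℕ) : HS t n / (n : ℝ) ^ (s + 1) * n = HS t n / (n : ℝ) ^ s := by
  rcases Nat.eq_zero_or_pos n with h | h
  · subst h; simp [HS]
  · rw [pow_succ]; field_simp

lemma DL_cont (s t : ℕ) {x : ℝ} (hx : |x| < 1) : ContinuousAt (DL (s + 1) t) x :=
  (PS_deriv' _ _ (DL_coef s t) (HSdiv_abs s t) hx).continuousAt

lemma DL_deriv (s t : ℕ) {x : ℝ} (hx : |x| < 1) (hx0 : x ≠ 0) :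
    HasDerivAt (DL (s + 1) t) (DL s t x / x) x :=
  PS_deriv _ _ (DL_coef s t) (HSdiv_abs s t) hx hx0

lemma DL1_deriv (t : ℕ) (ht : t ≠ 0) {x : ℝ} (hx : |x| < 1) (hx0 : x ≠ 0) :
    HasDerivAt (DL 1 t) (LiS t x / (1 - x)) x := by
  convert DL_deriv 0 t hx hx0 using 1
  have : DL 0 t x = PS (HS t) x := by simp [DL]
  rw [this, PS_HS t ht hx]
  field_simp

lemma const_of_s18 (f f' : ℝ → ℝ) {r : ℝ} (hc : ContinuousOn f (Icc 0 r))
    (hd : ∀ x ∈ Ioo 0 r, HasDerivAt f (f' x) x) (h0 : ∀ x ∈ Ioo 0 r, f' x = 0)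
    {x : ℝ} (hx : x ∈ Icc 0 r) : f x = f 0 := by
  rcases hx.1.eq_or_lt with h | h
  · rw [h]
  · obtain ⟨c, hc1, hc2⟩ := exists_hasDerivAt_eq_slope f f' h
      (hc.mono (Icc_subset_Icc_right hx.2))
      (fun y hy => hd y ⟨hy.1, hy.2.trans_le hx.2⟩)
    rw [h0 c ⟨hc1.1, hc1.2.trans_le hx.2⟩, eq_comm, div_eq_zero_iff] at hc2
    rcases hc2 with h2 | h2 <;> linarith

lemma log_sub_deriv {x : ℝ} (hx : x < 1) :
    HasDerivAt (fun y => Real.log (1 - y)) (-1 / (1 - x)) x := by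
  have h := ((hasDerivAt_id x).const_sub 1).log (by simp; linarith)
  simpa using h

lemma log_sub_cont : ContinuousOn (fun y => Real.log (1 - y)) (Icc 0 (1/2)) := by
  intro x hx
  exact (log_sub_deriv (by linarith [hx.2])).continuousAt.continuousWithinAt

lemma loglog_cont_s18 :
    ContinuousOn (fun y => Real.log y * Real.log (1 - y)) (Icc 0 (1/2)) := by
  intro x hx
  rcases hx.1.eq_or_lt with h | h
  · subst h
    rw [ContinuousWithinAt]
    simp only [Real.log_zero, zero_mul]
    have h1 : Tendsto (fun y : ℝ => 2 * |y * Real.log y|) (𝓝[Icc 0 (1/2)] 0) (𝓝 0) := by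
      have : Continuous (fun y : ℝ => 2 * |y * Real.log y|) :=
        continuous_const.mul Real.continuous_mul_log.abs
      have h2 := this.tendsto 0
      simp only [Real.log_zero, mul_zero, abs_zero] at h2
      exact h2.mono_left nhdsWithin_le_nhds
    refine squeeze_zero_norm' ?_ h1
    filter_upwards [self_mem_nhdsWithin] with y hy
    have hy2 := hy.2
    have hy1 := hy.1
    have h3 := Real.one_sub_inv_le_log_of_pos (x := 1 - y) (by linarith)
    have h4 : Real.log (1 - y) ≤ 0 := Real.log_nonpos (by linarith) (by linarith)
    have h5 : (1 - y)⁻¹ ≤ 1 + 2 * y := by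
      rw [inv_le_iff_one_le_mul₀ (by linarith)]
      nlinarith
    have h6 : |Real.log (1 - y)| ≤ 2 * y := by
      rw [abs_of_nonpos h4]; linarith
    rw [Real.norm_eq_abs, abs_mul, abs_mul, abs_of_nonneg hy1]
    nlinarith [abs_nonneg (Real.log y)]
  · exact ((Real.continuousAt_log h.ne').mul
      (log_sub_deriv (by linarith [hx.2])).continuousAt).continuousWithinAt

lemma abs_lt_of {x : ℝ} (h0 : 0 < x) (h1 : x < 1) : |x| < 1 := abs_lt.2 ⟨by linarith, h1⟩

lemma Li_cont_half (s : ℕ) (hs : 1 < s) : ContinuousOn (LiS s) (Icc 0 (1/2)) :=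
  (Li_cont s hs).mono (Icc_subset_Icc (by norm_num) (by norm_num))

lemma Li_cont_sub (s : ℕ) (hs : 1 < s) : ContinuousOn (fun y => LiS s (1 - y)) (Icc 0 (1/2)) :=
  (Li_cont s hs).comp (by fun_prop) (fun x hx => ⟨by linarith [hx.2], by linarith [hx.1]⟩)

lemma w_mem {x : ℝ} (hx : x ∈ Icc (0:ℝ) (1/2)) : -x / (1 - x) ∈ Icc (-1 : ℝ) 1 := by
  obtain ⟨h0, h1⟩ := hx
  have : 0 < 1 - x := by linarith
  constructor
  · rw [le_div_iff₀ this]; linarith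
  · rw [div_le_iff₀ this]; linarith

lemma w_abs {x : ℝ} (hx : x ∈ Ioo (0:ℝ) (1/2)) : |-x / (1 - x)| < 1 := by
  obtain ⟨h0, h1⟩ := hx
  have : 0 < 1 - x := by linarith
  rw [abs_lt]
  constructor
  · rw [lt_div_iff₀ this]; linarith
  · rw [div_lt_iff₀ this]; linarith

lemma Li_cont_w (s : ℕ) (hs : 1 < s) :
    ContinuousOn (fun y => LiS s (-y / (1 - y))) (Icc 0 (1/2)) := by
  refine (Li_cont s hs).comp ?_ (fun x hx => w_mem hx)
  refine ContinuousOn.div (by fun_prop) (by fun_prop) (fun x hx => ?_)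
  have := hx.2
  have : 0 < 1 - x := by linarith
  exact this.ne'

lemma w_deriv {x : ℝ} (hx : x < 1) :
    HasDerivAt (fun y : ℝ => -y / (1 - y)) (-1 / (1 - x) ^ 2) x := by
  have h1 : (1 - x) ≠ 0 := by linarith
  have h := ((hasDerivAt_id x).neg.div ((hasDerivAt_id x).const_sub 1) (by simpa using h1))
  refine h.congr_deriv ?_
  simp only [id]
  congr 1
  simp

lemma sub_deriv (x : ℝ) : HasDerivAt (fun y : ℝ => 1 - y) (-1) x := by
  simpa using (hasDerivAt_id x).const_sub 1

/-- `Li_{1,1} = log² / 2`. -/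
lemma DL11 {x : ℝ} (hx : x ∈ Icc (0:ℝ) (1/2)) : DL 1 1 x = Real.log (1 - x) ^ 2 / 2 := by
  have key := const_of_s18 (fun y => DL 1 1 y - Real.log (1 - y) ^ 2 / 2)
    (fun y => LiS 1 y / (1 - y) - 2 * Real.log (1 - y) * (-1 / (1 - y)) / 2) (r := 1/2)
    ?_ ?_ ?_ hx
  · simp only [DL_zero, sub_zero, Real.log_one] at key
    linarith
  · refine ContinuousOn.sub (fun y hy => ?_) ((log_sub_cont.pow 2).div_const 2)
    exact (DL_cont 0 1 (abs_lt.2 ⟨by linarith [hy.1], by linarith [hy.2]⟩)).continuousWithinAt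
  · intro y hy
    have h1 : y < 1 := by linarith [hy.2]
    have := (DL1_deriv 1 one_ne_zero (abs_lt_of hy.1 h1) hy.1.ne').sub
      (((log_sub_deriv h1).pow 2).div_const 2)
    exact this.congr_deriv (by norm_num)
  · intro y hy
    have h1 : y < 1 := by linarith [hy.2]
    rw [Li1_eq (abs_lt_of hy.1 h1)]
    ring

lemma DL_cont_half (s t : ℕ) : ContinuousOn (DL (s + 1) t) (Icc 0 (1/2)) := fun y hy =>
  (DL_cont s t (abs_lt.2 ⟨by linarith [hy.1], by linarith [hy.2]⟩)).continuousWithinAt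

lemma DL21_deriv {x : ℝ} (hx : x ∈ Ioo (0:ℝ) (1/2)) :
    HasDerivAt (DL 2 1) (Real.log (1 - x) ^ 2 / 2 / x) x := by
  rw [← DL11 ⟨hx.1.le, hx.2.le⟩]
  exact DL_deriv 1 1 (abs_lt_of hx.1 (by linarith [hx.2])) hx.1.ne'

lemma half_mem : (1/2 : ℝ) ∈ Icc (0:ℝ) (1/2) := ⟨by norm_num, le_refl _⟩

lemma log_half : Real.log (1/2) = -Real.log 2 := by
  rw [one_div, Real.log_inv]

/-- Shuffle relation. -/
lemma shuffle : LiS 2 (1/2) * Real.log 2 = 2 * DL 2 1 (1/2) + DL 1 2 (1/2) := by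
  have key := const_of_s18 (fun y => LiS 2 y * Real.log (1 - y) + 2 * DL 2 1 y + DL 1 2 y)
    (fun y => (-Real.log (1 - y) / y) * Real.log (1 - y) + LiS 2 y * (-1 / (1 - y))
      + 2 * (Real.log (1 - y) ^ 2 / 2 / y) + LiS 2 y / (1 - y)) (r := 1/2)
    ?_ ?_ ?_ half_mem
  · simp only [DL_zero, sub_zero, Real.log_one] at key
    rw [show (1 - 1/2 : ℝ) = 1/2 by norm_num, log_half] at key
    linarith
  · exact (((Li_cont_half 2 (by norm_num)).mul log_sub_cont).add
      ((DL_cont_half 1 1).const_mul 2)).add (DL_cont_half 0 2)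
  · intro y hy
    have h1 : y < 1 := by linarith [hy.2]
    have ha := abs_lt_of hy.1 h1
    exact (((Li2_deriv ha hy.1.ne').mul (log_sub_deriv h1)).add
      ((DL21_deriv hy).const_mul 2)).add (DL1_deriv 2 two_ne_zero ha hy.1.ne')
  · intro y hy
    ring

lemma Li2_sub_deriv {y : ℝ} (hy : y ∈ Ioo (0:ℝ) (1/2)) :
    HasDerivAt (fun z => LiS 2 (1 - z)) (-Real.log y / (1 - y) * (-1)) y := by
  have h1 : y < 1 := by linarith [hy.2]
  have h := (Li2_deriv (x := 1 - y) (abs_lt_of (by linarith) (by linarith [hy.1]))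
    (by linarith)).comp y (sub_deriv y)
  rw [sub_sub_cancel] at h
  exact h

lemma Li3_sub_deriv {y : ℝ} (hy : y ∈ Ioo (0:ℝ) (1/2)) :
    HasDerivAt (fun z => LiS 3 (1 - z)) (LiS 2 (1 - y) / (1 - y) * (-1)) y := by
  have h1 : y < 1 := by linarith [hy.2]
  exact (Li_deriv 2 two_ne_zero (x := 1 - y) (abs_lt_of (by linarith) (by linarith [hy.1]))
    (by linarith)).comp y (sub_deriv y)

/-- Euler reflection at `1/2`. -/
lemma Li2_half : 2 * LiS 2 (1/2) + Real.log 2 ^ 2 = LiS 2 1 := by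
  have key := const_of_s18 (fun y => LiS 2 y + LiS 2 (1 - y) + Real.log y * Real.log (1 - y))
    (fun y => (-Real.log (1 - y) / y) + (-Real.log y / (1 - y) * (-1))
      + (y⁻¹ * Real.log (1 - y) + Real.log y * (-1 / (1 - y)))) (r := 1/2)
    ?_ ?_ ?_ half_mem
  · simp only [Li_zero 2 two_ne_zero, sub_zero, Real.log_one] at key
    rw [show (1 - 1/2 : ℝ) = 1/2 by norm_num, log_half] at key
    linarith
  · exact ((Li_cont_half 2 (by norm_num)).add (Li_cont_sub 2 (by norm_num))).add loglog_cont_s18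
  · intro y hy
    have h1 : y < 1 := by linarith [hy.2]
    have ha := abs_lt_of hy.1 h1
    exact ((Li2_deriv ha hy.1.ne').add (Li2_sub_deriv hy)).add
      ((Real.hasDerivAt_log hy.1.ne').mul (log_sub_deriv h1))
  · intro y hy
    ring

/-- Landen for `Li₂`. -/
lemma landen2 {x : ℝ} (hx : x ∈ Icc (0:ℝ) (1/2)) :
    LiS 2 (-x / (1 - x)) = -LiS 2 x - Real.log (1 - x) ^ 2 / 2 := by
  have key := const_of_s18
    (fun y => LiS 2 (-y / (1 - y)) + LiS 2 y + Real.log (1 - y) ^ 2 / 2)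
    (fun y => (-Real.log (1 - -y / (1 - y)) / (-y / (1 - y))) * (-1 / (1 - y) ^ 2)
      + (-Real.log (1 - y) / y) + 2 * Real.log (1 - y) * (-1 / (1 - y)) / 2) (r := 1/2)
    ?_ ?_ ?_ hx
  · simp only [Li_zero 2 two_ne_zero, sub_zero, Real.log_one, neg_zero, zero_div] at key
    linarith
  · exact ((Li_cont_w 2 (by norm_num)).add (Li_cont_half 2 (by norm_num))).add
      ((log_sub_cont.pow 2).div_const 2)
  · intro y hy
    have h1 : y < 1 := by linarith [hy.2]
    have ha := abs_lt_of hy.1 h1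
    have hw : -y / (1 - y) ≠ 0 := div_ne_zero (neg_ne_zero.2 hy.1.ne') (by linarith)
    have h2 := (Li2_deriv (w_abs hy) hw).comp y (w_deriv h1)
    have h3 := ((log_sub_deriv h1).pow 2).div_const 2
    exact ((h2.add (Li2_deriv ha hy.1.ne')).add h3).congr_deriv (by norm_num)
  · intro y hy
    have h1 : 0 < 1 - y := by linarith [hy.2]
    have h0 := hy.1
    have : 1 - -y / (1 - y) = (1 - y)⁻¹ := by field_simp; ring
    rw [this, Real.log_inv]
    field_simp
    ring

/-- Landen for `Li₃`, with double polylogarithms. -/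
lemma landen3 : LiS 3 (-1) + LiS 3 (1/2) + DL 2 1 (1/2) + DL 1 2 (1/2)
    + Real.log 2 ^ 3 / 6 = 0 := by
  have key := const_of_s18
    (fun y => LiS 3 (-y / (1 - y)) + LiS 3 y + DL 2 1 y + DL 1 2 y - Real.log (1 - y) ^ 3 / 6)
    (fun y => (LiS 2 (-y / (1 - y)) / (-y / (1 - y))) * (-1 / (1 - y) ^ 2)
      + LiS 2 y / y + Real.log (1 - y) ^ 2 / 2 / y + LiS 2 y / (1 - y)
      - 3 * Real.log (1 - y) ^ 2 * (-1 / (1 - y)) / 6) (r := 1/2)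
    ?_ ?_ ?_ half_mem
  · simp only [Li_zero 3 three_ne_zero, DL_zero, sub_zero, Real.log_one, neg_zero, zero_div] at key
    rw [show (1 - 1/2 : ℝ) = 1/2 by norm_num, log_half,
      show (-(1/2) / (1/2) : ℝ) = -1 by norm_num] at key
    linarith
  · exact ((((Li_cont_w 3 (by norm_num)).add (Li_cont_half 3 (by norm_num))).add
      (DL_cont_half 1 1)).add (DL_cont_half 0 2)).sub ((log_sub_cont.pow 3).div_const 6)
  · intro y hy
    have h1 : y < 1 := by linarith [hy.2]
    have ha := abs_lt_of hy.1 h1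
    have hw : -y / (1 - y) ≠ 0 := div_ne_zero (neg_ne_zero.2 hy.1.ne') (by linarith)
    have h2 := (Li_deriv 2 two_ne_zero (w_abs hy) hw).comp y (w_deriv h1)
    have h3 := ((log_sub_deriv h1).pow 3).div_const 6
    exact ((((h2.add (Li_deriv 2 two_ne_zero ha hy.1.ne')).add (DL21_deriv hy)).add
      (DL1_deriv 2 two_ne_zero ha hy.1.ne')).sub h3).congr_deriv (by norm_num)
  · intro y hy
    have h1 : 0 < 1 - y := by linarith [hy.2]
    have h0 := hy.1
    rw [landen2 ⟨hy.1.le, hy.2.le⟩]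
    field_simp
    ring

lemma DL21_half : DL 2 1 (1/2) + LiS 3 (1/2) + Real.log 2 * LiS 2 (1/2) + Real.log 2 ^ 3 / 2
    = LiS 3 1 := by
  have key := const_of_s18
    (fun y => DL 2 1 y + LiS 3 (1 - y) - Real.log (1 - y) * LiS 2 (1 - y)
      - (Real.log y * Real.log (1 - y)) * Real.log (1 - y) / 2)
    (fun y => Real.log (1 - y) ^ 2 / 2 / y + LiS 2 (1 - y) / (1 - y) * (-1)
      - ((-1 / (1 - y)) * LiS 2 (1 - y) + Real.log (1 - y) * (-Real.log y / (1 - y) * (-1)))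
      - ((y⁻¹ * Real.log (1 - y) + Real.log y * (-1 / (1 - y))) * Real.log (1 - y)
        + (Real.log y * Real.log (1 - y)) * (-1 / (1 - y))) / 2) (r := 1/2)
    ?_ ?_ ?_ half_mem
  · simp only [DL_zero, sub_zero, Real.log_one] at key
    rw [show (1 - 1/2 : ℝ) = 1/2 by norm_num, log_half] at key
    linarith
  · exact (((DL_cont_half 1 1).add (Li_cont_sub 3 (by norm_num))).sub
      (log_sub_cont.mul (Li_cont_sub 2 (by norm_num)))).sub
      ((loglog_cont_s18.mul log_sub_cont).div_const 2)
  · intro y hy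
    have h1 : y < 1 := by linarith [hy.2]
    exact (((DL21_deriv hy).add (Li3_sub_deriv hy)).sub
      ((log_sub_deriv h1).mul (Li2_sub_deriv hy))).sub
      ((((Real.hasDerivAt_log hy.1.ne').mul (log_sub_deriv h1)).mul (log_sub_deriv h1)).div_const 2)
  · intro y hy
    ring

lemma Li3_neg_one : LiS 3 (-1) = -(3/4) * LiS 3 1 := by
  have hs : Summable (fun n : ℕ => 1 / (n : ℝ) ^ 3) :=
    Real.summable_one_div_nat_pow.2 (by norm_num)
  have he : Summable (fun n : ℕ => 1 / ((2 * n : ℕ) : ℝ) ^ 3) :=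
    hs.comp_injective (fun a b h => by simpa using h)
  have ho : Summable (fun n : ℕ => 1 / ((2 * n + 1 : ℕ) : ℝ) ^ 3) :=
    hs.comp_injective (fun a b h => by simpa using h)
  have h1 := tsum_even_add_odd (f := fun n : ℕ => 1 / (n : ℝ) ^ 3) he ho
  have h3 : HasSum (fun n : ℕ => 1 / (n : ℝ) ^ 3 * (-1) ^ n)
      ((∑' n : ℕ, 1 / ((2 * n : ℕ) : ℝ) ^ 3) + -∑' n : ℕ, 1 / ((2 * n + 1 : ℕ) : ℝ) ^ 3) := by
    refine HasSum.even_add_odd ?_ ?_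
    · simpa [pow_mul] using he.hasSum
    · simpa [pow_succ, pow_mul] using ho.hasSum.neg
  have h4 : (∑' n : ℕ, 1 / ((2 * n : ℕ) : ℝ) ^ 3) = (1/8) * ∑' n : ℕ, 1 / (n : ℝ) ^ 3 := by
    rw [← tsum_mul_left]
    congr 1
    ext n
    push_cast
    rw [mul_pow, one_div_mul_one_div]
    norm_num
  have h5 : LiS 3 1 = ∑' n : ℕ, 1 / (n : ℝ) ^ 3 := by simp [LiS, PS]
  rw [h5, LiS, PS, h3.tsum_eq]
  linarith

lemma deltaD_eq (s t : ℕ) (ht : t ≠ 0) : deltaD s t = DL s t (1/2) := by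
  rw [deltaD, DL, PS]
  congr 1
  ext n
  rw [tsum_eq_sum (s := Finset.range n)]
  · rw [HS, Finset.sum_div, Finset.sum_mul]
    refine Finset.sum_congr rfl (fun m hm => ?_)
    have hm' := Finset.mem_range.1 hm
    rcases Nat.eq_zero_or_pos m with h | h
    · subst h; simp [ht]
    · rw [if_pos ⟨h, hm'⟩]
      field_simp
  · intro m hm
    rw [if_neg]
    rintro ⟨_, h⟩
    exact hm (Finset.mem_range.2 h)

theorem delta_1_2 :
    deltaD 1 2 = (∑' n : ℕ, 1 / (n : ℝ) ^ 2) * Real.log 2 / 2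
        - (Real.log 2) ^ 3 / 6 - (∑' n : ℕ, 1 / (n : ℝ) ^ 3) / 4
    ∧ (∑' n : ℕ, (1/2 : ℝ) ^ n / (n : ℝ) ^ 2) * Real.log 2
        = 2 * deltaD 2 1 + deltaD 1 2 := by
  have h2 : LiS 2 1 = ∑' n : ℕ, 1 / (n : ℝ) ^ 2 := by simp [LiS, PS]
  have h3 : LiS 3 1 = ∑' n : ℕ, 1 / (n : ℝ) ^ 3 := by simp [LiS, PS]
  have h4 : LiS 2 (1/2) = ∑' n : ℕ, (1/2 : ℝ) ^ n / (n : ℝ) ^ 2 := by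
    rw [LiS, PS]
    congr 1
    ext n
    ring
  rw [deltaD_eq 1 2 two_ne_zero, deltaD_eq 2 1 one_ne_zero, ← h2, ← h3, ← h4]
  refine ⟨?_, shuffle⟩
  have e1 := shuffle
  have e2 := landen3
  have e3 := DL21_half
  rw [Li3_neg_one] at e2
  rw [← Li2_half]
  linarith
end
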